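/- Let n ≥ 2 be an integer and let k, l be natural numbers with l ≥ k, l − k even, and (n,k) ≠ (2,0). Put β = (n−2)/2, α = β + k, m = l − k. Then ∫_{−1}^{1} P_k^{n+1}(t) · P_l^n(t) · (1−t²)^{(n−2)/2} dt = ((β+l)/(N(n,l)·(β+k))) · c^α_m, where N(n,l) = (2l+n−2)·((l+n−3)!)/(l!·(n−2)!) and c^α_m = −α · 4^{α+1/2} · m! · Γ(m/2+α+1)² / ((m−1)·(m/2+α)·Γ(m+2α+2)·Γ(m/2+1)²). -/

import Mathlib

/-- The Legendre polynomial `P_k^n` of dimension `n` and degree `k`, defined on `(-1,1)`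
via Rodrigues' formula. -/
noncomputable def legendreP (n k : ℕ) (t : ℝ) : ℝ :=
  ((-1 : ℝ) ^ k / (2 ^ k * (ascPochhammer ℝ k).eval (((n : ℝ) - 1) / 2))) *
    (1 - t ^ 2) ^ (-(((n : ℝ) - 3) / 2)) *
    iteratedDeriv k (fun s : ℝ => (1 - s ^ 2) ^ (((n : ℝ) - 3) / 2 + (k : ℝ))) t

/-- `N(n,l) = (2l+n−2)((l+n−3)!)/(l!(n−2)!)`, the dimension of the space of spherical
harmonics of dimension `n` and degree `l`. -/
noncomputable def Ndim (n l : ℕ) : ℝ :=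
  ((2 * l + n - 2 : ℕ) : ℝ) * (Nat.factorial (l + n - 3) : ℝ) /
    ((Nat.factorial l : ℝ) * (Nat.factorial (n - 2) : ℝ))

/-- `c^α_m = ∫_{−1}^1 (1−t²)^α C^α_m(t) dt`, in closed Gamma-function form:
`c^α_m = −α 4^{α+1/2} m! Γ(m/2+α+1)² / ((m−1)(m/2+α) Γ(m+2α+2) Γ(m/2+1)²)`. -/
noncomputable def cGeg (α : ℝ) (m : ℕ) : ℝ :=
  -(α * (4 : ℝ) ^ (α + 1 / 2) * (Nat.factorial m : ℝ) *
      (Real.Gamma ((m : ℝ) / 2 + α + 1)) ^ 2) /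
    (((m : ℝ) - 1) * ((m : ℝ) / 2 + α) * Real.Gamma ((m : ℝ) + 2 * α + 2) *
      (Real.Gamma ((m : ℝ) / 2 + 1)) ^ 2)

open Polynomial

/-- Gegenbauer polynomials of index `a`, normalized to the value `1` at `1`. -/
noncomputable def gegenbauer : ℕ → ℝ → ℝ[X]
  | 0, _ => 1
  | n + 1, a => X * gegenbauer n (a + 1) -
      C (2 * a + 1)⁻¹ * ((1 - X ^ 2) * derivative (gegenbauer n (a + 1)))

theorem gegenbauer_succ (n : ℕ) {a : ℝ} (ha : 0 < 2 * a + 1) :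
    C (2 * a + 1) * gegenbauer (n + 1) a = C (2 * a + 1) * X * gegenbauer n (a + 1) -
      (1 - X ^ 2) * derivative (gegenbauer n (a + 1)) := by
  have h : C (2 * a + 1) * C (2 * a + 1)⁻¹ = (1 : ℝ[X]) := by
    rw [← C_mul, mul_inv_cancel₀ ha.ne', C_1]
  rw [gegenbauer]
  linear_combination (-(1 - X ^ 2) * derivative (gegenbauer n (a + 1))) * h

theorem C_mul_left_cancel {c : ℝ} (hc : 0 < c) {p q : ℝ[X]} (h : C c * p = C c * q) : p = q :=
  mul_left_cancel₀ (C_ne_zero.2 hc.ne') h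

theorem gegenbauer_ode_of_derivative (n : ℕ) {a : ℝ} (ha : 0 < 2 * a + 1)
    (h : C (2 * a + 1) * derivative (gegenbauer (n + 1) a) =
      C ((n + 1) * (n + 1 + 2 * a)) * gegenbauer n (a + 1)) :
    (1 - X ^ 2) * derivative (derivative (gegenbauer (n + 1) a)) -
      C (2 * a + 1) * X * derivative (gegenbauer (n + 1) a) +
      C ((n + 1) * (n + 1 + 2 * a)) * gegenbauer (n + 1) a = 0 := by
  have h' := congrArg derivative h
  simp only [derivative_C_mul] at h'
  refine C_mul_left_cancel ha ?_
  linear_combination (1 - X ^ 2) * h' - C (2 * a + 1) * X * h +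
    C ((n + 1) * (n + 1 + 2 * a)) * gegenbauer_succ n ha

theorem derivative_gegenbauer_succ (n : ℕ) {a : ℝ} (ha : 0 < 2 * a + 1) :
    C (2 * a + 1) * derivative (gegenbauer (n + 1) a) =
      C ((n + 1) * (n + 1 + 2 * a)) * gegenbauer n (a + 1) := by
  induction n generalizing a with
  | zero => simp [gegenbauer, add_comm]
  | succ n ih =>
    have ha' : 0 < 2 * (a + 1) + 1 := by linarith
    have ode := gegenbauer_ode_of_derivative n ha' (ih ha')
    have h := congrArg derivative (gegenbauer_succ (n + 1) ha)
    simp only [derivative_mul, derivative_C, derivative_X, derivative_sub, derivative_one,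
      derivative_X_pow, zero_mul, zero_add] at h
    simp only [map_add, map_mul, map_one, map_natCast, map_ofNat, Nat.cast_add, Nat.cast_one,
      Nat.cast_ofNat] at h ode ⊢
    linear_combination h - ode

theorem gegenbauer_mixed (n : ℕ) {a : ℝ} (ha : 0 < 2 * a + 1) :
    (1 - X ^ 2) * derivative (gegenbauer (n + 1) a) =
        C ((n : ℝ) + 1) * (gegenbauer n a - X * gegenbauer (n + 1) a) ∧
      (1 - X ^ 2) * derivative (gegenbauer n a) =
        C (n + 2 * a) * (X * gegenbauer n a - gegenbauer (n + 1) a) := by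
  induction n generalizing a with
  | zero => simp [gegenbauer, pow_two]
  | succ n ih =>
    have ha' : 0 < 2 * (a + 1) + 1 := by linarith
    obtain ⟨h₁, h₂⟩ := ih ha'
    have s₁ := gegenbauer_succ n ha
    have s₂ := gegenbauer_succ (n + 1) ha
    have d₁ := derivative_gegenbauer_succ n ha
    have d₂ := derivative_gegenbauer_succ (n + 1) ha
    rw [h₂] at s₁
    rw [h₁] at s₂
    constructor <;> refine C_mul_left_cancel ha ?_ <;>
    simp only [map_add, map_mul, map_one, map_natCast, map_ofNat, Nat.cast_add,
      Nat.cast_one] at s₁ s₂ d₁ d₂ ⊢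
    · linear_combination (1 - X ^ 2) * d₂ - (n + 2 : ℝ[X]) * (s₁ - X * s₂)
    · linear_combination (1 - X ^ 2) * d₁ - (n + 1 + 2 * C a) * (X * s₁ - s₂)

theorem one_sub_sq_nonneg {t : ℝ} (ht : t ∈ Set.Icc (-1 : ℝ) 1) : 0 ≤ 1 - t ^ 2 := by
  nlinarith [ht.1, ht.2]

theorem hasDerivAt_one_sub_sq_rpow {p t : ℝ} (h : 1 - t ^ 2 ≠ 0 ∨ 1 ≤ p) :
    HasDerivAt (fun s : ℝ => (1 - s ^ 2) ^ p) (-(2 * t) * p * (1 - t ^ 2) ^ (p - 1)) t := by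
  have h₁ : HasDerivAt (fun s : ℝ => 1 - s ^ 2) (-(2 * t)) t := by
    simpa using (hasDerivAt_pow 2 t).const_sub 1
  exact h₁.rpow_const h

theorem hasDerivAt_one_sub_sq_rpow_mul_gegenbauer (n : ℕ) {a t : ℝ} (ha : 0 < 2 * a + 1)
    (ht : t ∈ Set.Icc (-1 : ℝ) 1) (h : 1 - t ^ 2 ≠ 0 ∨ 1 ≤ a + 1 / 2) :
    HasDerivAt (fun s : ℝ => (1 - s ^ 2) ^ (a + 1 / 2) * (gegenbauer n (a + 1)).eval s)
      (-(2 * a + 1) * (1 - t ^ 2) ^ (a - 1 / 2) * (gegenbauer (n + 1) a).eval t) t := by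
  refine ((hasDerivAt_one_sub_sq_rpow h).mul
    ((gegenbauer n (a + 1)).hasDerivAt t)).congr_deriv ?_
  have hp : (1 - t ^ 2) ^ (a + 1 / 2) = (1 - t ^ 2) ^ (a - 1 / 2) * (1 - t ^ 2) := by
    rw [← Real.rpow_add_one' (one_sub_sq_nonneg ht) (by linarith)]
    ring_nf
  have hs := congrArg (eval t) (gegenbauer_succ n ha)
  simp only [eval_mul, eval_sub, eval_C, eval_X, eval_one, eval_pow] at hs
  rw [hp, show a + 1 / 2 - 1 = a - 1 / 2 by ring]
  linear_combination (1 - t ^ 2) ^ (a - 1 / 2) * hs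

theorem iteratedDeriv_one_sub_sq_rpow (l : ℕ) {a t : ℝ} (ha : 0 < 2 * a + 1)
    (ht : t ∈ Set.Ioo (-1 : ℝ) 1) :
    iteratedDeriv l (fun s : ℝ => (1 - s ^ 2) ^ (a - 1 / 2 + l)) t =
      (-2) ^ l * (ascPochhammer ℝ l).eval (a + 1 / 2) * (1 - t ^ 2) ^ (a - 1 / 2) *
        (gegenbauer l a).eval t := by
  induction l generalizing a t with
  | zero => simp [gegenbauer]
  | succ l ih =>
    have ha' : 0 < 2 * (a + 1) + 1 := by linarith
    have hne : 1 - t ^ 2 ≠ 0 := by nlinarith [ht.1, ht.2]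
    have hev : iteratedDeriv l (fun s : ℝ => (1 - s ^ 2) ^ (a - 1 / 2 + (l + 1 : ℕ))) =ᶠ[nhds t]
        fun s => ((-2) ^ l * (ascPochhammer ℝ l).eval (a + 1 + 1 / 2)) *
          ((1 - s ^ 2) ^ (a + 1 / 2) * (gegenbauer l (a + 1)).eval s) := by
      filter_upwards [isOpen_Ioo.mem_nhds ht] with s hs
      rw [show a - 1 / 2 + ((l + 1 : ℕ) : ℝ) = a + 1 - 1 / 2 + l by push_cast; ring, ih ha' hs,
        show a + 1 - 1 / 2 = a + 1 / 2 by ring]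
      ring
    rw [iteratedDeriv_succ, hev.deriv_eq, ((hasDerivAt_one_sub_sq_rpow_mul_gegenbauer l ha
      (Set.Ioo_subset_Icc_self ht) (.inl hne)).const_mul _).deriv, ascPochhammer_succ_left]
    simp only [eval_mul, eval_X, eval_comp, eval_add, eval_one]
    rw [show a + 1 / 2 + 1 = a + 1 + 1 / 2 by ring]
    ring

theorem legendreP_eq_gegenbauer {n : ℕ} (hn : 2 ≤ n) (l : ℕ) {t : ℝ}
    (ht : t ∈ Set.Ioo (-1 : ℝ) 1) :
    legendreP n l t = (gegenbauer l (((n : ℝ) - 2) / 2)).eval t := by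
  have hn' : (2 : ℝ) ≤ n := by exact_mod_cast hn
  have hpos : 0 < 1 - t ^ 2 := by nlinarith [ht.1, ht.2]
  have hasc : (ascPochhammer ℝ l).eval (((n : ℝ) - 1) / 2) ≠ 0 :=
    (ascPochhammer_pos l _ (by linarith)).ne'
  have h := iteratedDeriv_one_sub_sq_rpow l (a := ((n : ℝ) - 2) / 2) (by linarith) ht
  rw [show ((n : ℝ) - 2) / 2 - 1 / 2 = ((n : ℝ) - 3) / 2 by ring,
    show ((n : ℝ) - 2) / 2 + 1 / 2 = ((n : ℝ) - 1) / 2 by ring] at h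
  have hrp := (Real.rpow_pos_of_pos hpos (((n : ℝ) - 3) / 2)).ne'
  have hsign : (-1 : ℝ) ^ l * (-2) ^ l = 2 ^ l := by
    rw [← mul_pow]
    norm_num
  rw [legendreP, h, Real.rpow_neg hpos.le]
  field_simp
  linear_combination (eval t (gegenbauer l (((n : ℝ) - 2) / 2))) * hsign

theorem continuous_one_sub_sq_rpow {p : ℝ} (hp : 0 ≤ p) :
    Continuous fun s : ℝ => (1 - s ^ 2) ^ p :=
  Continuous.rpow_const (by fun_prop) fun _ => .inr hp

theorem integral_gegenbauer_mixed_succ {b : ℝ} (hb : 0 ≤ b) (k l : ℕ) :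
    (2 * b + 2) * (2 * b + 1) * ∫ t in (-1 : ℝ)..1, (gegenbauer (k + 1) (b + 1 / 2)).eval t *
        (gegenbauer (l + 1) b).eval t * (1 - t ^ 2) ^ b =
      (l + 1) * (l + 1 + 2 * b) * ∫ t in (-1 : ℝ)..1, (gegenbauer k (b + 1 + 1 / 2)).eval t *
        (gegenbauer l (b + 1)).eval t * (1 - t ^ 2) ^ (b + 1) := by
  have hc := continuous_one_sub_sq_rpow hb
  have key := intervalIntegral.integral_mul_deriv_eq_deriv_mul (a := (-1 : ℝ)) (b := 1)
    (u := fun t => (gegenbauer (l + 1) b).eval t)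
    (u' := fun t => (derivative (gegenbauer (l + 1) b)).eval t)
    (v := fun t => (1 - t ^ 2) ^ (b + 1 / 2 + 1 / 2) * (gegenbauer k (b + 1 / 2 + 1)).eval t)
    (v' := fun t => -(2 * (b + 1 / 2) + 1) * (1 - t ^ 2) ^ (b + 1 / 2 - 1 / 2) *
      (gegenbauer (k + 1) (b + 1 / 2)).eval t)
    (fun t _ => (gegenbauer (l + 1) b).hasDerivAt t)
    (fun t ht => hasDerivAt_one_sub_sq_rpow_mul_gegenbauer k (by linarith)
      (by simpa using ht) (.inr (by linarith)))
    (Continuous.intervalIntegrable (by fun_prop) _ _)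
    (Continuous.intervalIntegrable (by simp only [add_sub_cancel_right]; fun_prop) _ _)
  have hd : ∀ t, (2 * b + 1) * (derivative (gegenbauer (l + 1) b)).eval t =
      (l + 1) * (l + 1 + 2 * b) * (gegenbauer l (b + 1)).eval t := fun t => by
    simpa using congrArg (eval t) (derivative_gegenbauer_succ l (a := b) (by linarith))
  have h0 : (0 : ℝ) ^ (b + 1) = 0 := Real.zero_rpow (by linarith)
  simp only [add_sub_cancel_right, show b + 1 / 2 + 1 / 2 = b + 1 by ring, one_pow, even_two,
    Even.neg_pow, sub_self, h0, zero_mul, mul_zero, zero_sub,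
    show b + 1 / 2 + 1 = b + 1 + 1 / 2 by ring] at key
  calc _ = -(2 * b + 1) * ∫ t in (-1 : ℝ)..1, (gegenbauer (l + 1) b).eval t *
        (-(2 * (b + 1 / 2) + 1) * (1 - t ^ 2) ^ b * (gegenbauer (k + 1) (b + 1 / 2)).eval t) := by
        rw [mul_comm (2 * b + 2), mul_assoc, neg_mul, ← mul_neg,
          ← intervalIntegral.integral_const_mul, ← intervalIntegral.integral_neg]
        congr 2
        ext t
        ring
    _ = _ := by
        rw [key, neg_mul_neg, ← intervalIntegral.integral_const_mul,
          ← intervalIntegral.integral_const_mul]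
        congr 1
        ext t
        linear_combination (1 - t ^ 2) ^ (b + 1) * (gegenbauer k (b + 1 + 1 / 2)).eval t * hd t

/-- The integral of a normalized Gegenbauer polynomial of index `a` against `(1 - t ^ 2) ^ a`. -/
noncomputable def gegenbauerIntegral (n : ℕ) (a : ℝ) : ℝ :=
  ∫ t in (-1 : ℝ)..1, (gegenbauer n a).eval t * (1 - t ^ 2) ^ a

theorem gegenbauerIntegral_add_two (n : ℕ) {a : ℝ} (ha : 0 ≤ a) :
    (n + 1 + 2 * a) * (n + 3 + 2 * a) * gegenbauerIntegral (n + 2) a =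
      (n + 1) * (n - 1) * gegenbauerIntegral n a := by
  have hc := continuous_one_sub_sq_rpow ha
  have hi : ∀ p : ℝ[X], IntervalIntegrable (fun t : ℝ => p.eval t * (1 - t ^ 2) ^ a)
      MeasureTheory.volume (-1) 1 := fun p => Continuous.intervalIntegrable (by fun_prop) _ _
  have hparts := intervalIntegral.integral_mul_deriv_eq_deriv_mul (a := (-1 : ℝ)) (b := 1)
    (u := fun t => (gegenbauer (n + 1) a).eval t)
    (u' := fun t => (derivative (gegenbauer (n + 1) a)).eval t)
    (v := fun t => (1 - t ^ 2) ^ (a + 1))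
    (v' := fun t => -(2 * t) * (a + 1) * (1 - t ^ 2) ^ (a + 1 - 1))
    (fun t _ => (gegenbauer (n + 1) a).hasDerivAt t)
    (fun t _ => hasDerivAt_one_sub_sq_rpow (.inr (by linarith)))
    (Continuous.intervalIntegrable (by fun_prop) _ _)
    (Continuous.intervalIntegrable (by simp only [add_sub_cancel_right]; fun_prop) _ _)
  have h0 : (0 : ℝ) ^ (a + 1) = 0 := Real.zero_rpow (by linarith)
  simp only [add_sub_cancel_right, one_pow, even_two, Even.neg_pow, sub_self, h0, mul_zero,
    zero_sub] at hparts
  set T := ∫ t in (-1 : ℝ)..1, (X * gegenbauer (n + 1) a).eval t * (1 - t ^ 2) ^ a with hT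
  have hD : ∫ t in (-1 : ℝ)..1, ((1 - X ^ 2) * derivative (gegenbauer (n + 1) a)).eval t *
      (1 - t ^ 2) ^ a = 2 * (a + 1) * T := by
    rw [hT, ← intervalIntegral.integral_const_mul, ← neg_inj, ← intervalIntegral.integral_neg]
    refine Eq.trans ?_ (hparts.symm.trans ?_)
    · rw [← intervalIntegral.integral_neg]
      refine intervalIntegral.integral_congr fun t ht => ?_
      have ht' : t ∈ Set.Icc (-1 : ℝ) 1 := by simpa using ht
      simp only [Real.rpow_add_one' (one_sub_sq_nonneg ht') (show a + 1 ≠ 0 by linarith),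
        eval_mul, eval_sub, eval_one, eval_pow, eval_X]
      ring
    · rw [← intervalIntegral.integral_neg]
      congr 1
      ext t
      simp only [eval_mul, eval_X]
      ring
  have hlin : ∀ (c : ℝ) (p q : ℝ[X]), ∫ t in (-1 : ℝ)..1, (C c * (p - q)).eval t *
      (1 - t ^ 2) ^ a = c * ((∫ t in (-1 : ℝ)..1, p.eval t * (1 - t ^ 2) ^ a) -
        ∫ t in (-1 : ℝ)..1, q.eval t * (1 - t ^ 2) ^ a) := fun c p q => by
    rw [← intervalIntegral.integral_sub (hi p) (hi q), ← intervalIntegral.integral_const_mul]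
    congr 1
    ext t
    simp only [eval_mul, eval_sub, eval_C]
    ring
  have h₁ := hD
  rw [(gegenbauer_mixed n (by linarith)).1, hlin] at h₁
  have h₂ := hD
  rw [(gegenbauer_mixed (n + 1) (by linarith)).2, hlin] at h₂
  push_cast at h₂
  simp only [← hT] at h₁ h₂
  change _ * (gegenbauerIntegral n a - T) = _ at h₁
  change _ * (T - gegenbauerIntegral (n + 2) a) = _ at h₂
  linear_combination (-(n + 3 + 2 * a)) * h₂ - (n - 1 : ℝ) * h₁

theorem integral_rpow_mul_one_sub_rpow {a : ℝ} (ha : -1 < a) :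
    ∫ t in (0 : ℝ)..1, t ^ a * (1 - t) ^ a =
      Real.Gamma (a + 1) ^ 2 / Real.Gamma (2 * a + 2) := by
  have h := ProbabilityTheory.beta_eq_betaIntegralReal (a + 1) (a + 1) (by linarith)
    (by linarith)
  rw [ProbabilityTheory.beta, ← pow_two, show a + 1 + (a + 1) = 2 * a + 2 by ring] at h
  rw [h, Complex.betaIntegral, ← Complex.ofReal_re (∫ t in (0 : ℝ)..1, t ^ a * (1 - t) ^ a),
    ← intervalIntegral.integral_ofReal]
  congr 1
  refine intervalIntegral.integral_congr fun t ht => ?_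
  rw [Set.uIcc_of_le zero_le_one] at ht
  push_cast
  rw [Complex.ofReal_cpow ht.1, Complex.ofReal_cpow (sub_nonneg.2 ht.2)]
  simp

theorem gegenbauerIntegral_zero {a : ℝ} (ha : -1 < a) :
    gegenbauerIntegral 0 a =
      (4 : ℝ) ^ (a + 1 / 2) * Real.Gamma (a + 1) ^ 2 / Real.Gamma (2 * a + 2) := by
  have hsub := intervalIntegral.integral_comp_mul_sub (a := 0) (b := 1)
    (fun t : ℝ => (1 - t ^ 2) ^ a) two_ne_zero 1
  have hcongr : ∫ t in (0 : ℝ)..1, (1 - (2 * t - 1) ^ 2) ^ a =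
      4 ^ a * ∫ t in (0 : ℝ)..1, t ^ a * (1 - t) ^ a := by
    rw [← intervalIntegral.integral_const_mul]
    refine intervalIntegral.integral_congr fun t ht => ?_
    rw [Set.uIcc_of_le zero_le_one] at ht
    have h1 := sub_nonneg.2 ht.2
    change (1 - (2 * t - 1) ^ 2) ^ a = 4 ^ a * (t ^ a * (1 - t) ^ a)
    rw [← Real.mul_rpow ht.1 h1, ← Real.mul_rpow (by norm_num) (mul_nonneg ht.1 h1)]
    ring_nf
  have h4 : (4 : ℝ) ^ (a + 1 / 2) = 4 ^ a * 2 := by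
    rw [Real.rpow_add (by norm_num), ← Real.sqrt_eq_rpow, show (4 : ℝ) = 2 ^ 2 by norm_num,
      Real.sqrt_sq (by norm_num)]
  rw [hcongr, integral_rpow_mul_one_sub_rpow ha] at hsub
  norm_num at hsub
  simp only [gegenbauerIntegral, gegenbauer, eval_one, one_mul]
  rw [h4]
  linear_combination (-2) * hsub

/-- The closed form of `∫ P_k P_l (1 - t ^ 2) ^ b` over `[-1, 1]`, where `P_k` and `P_l` are the
normalized Gegenbauer polynomials of indices `b + 1 / 2` and `b`, and `l = k + 2 * r`. -/
noncomputable def mixedIntegralValue (b : ℝ) (k r : ℕ) : ℝ :=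
  -((Nat.factorial (k + 2 * r) : ℝ) * Real.Gamma (2 * b + 1) * (4 : ℝ) ^ (b + k + 1 / 2) *
      (Nat.factorial (2 * r) : ℝ) * Real.Gamma (r + b + k + 1) ^ 2) /
    (2 * Real.Gamma (k + 2 * r + 2 * b) * (2 * r - 1) * (r + b + k) *
      Real.Gamma (2 * r + 2 * (b + k) + 2) * (Nat.factorial r : ℝ) ^ 2)

theorem two_mul_natCast_sub_one_ne_zero (r : ℕ) : (2 * r - 1 : ℝ) ≠ 0 := by
  intro h
  have : 2 * r = 1 := by exact_mod_cast sub_eq_zero.1 h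
  omega

theorem gegenbauerIntegral_two_mul (r : ℕ) {a : ℝ} (ha : 0 < a) :
    gegenbauerIntegral (2 * r) a = mixedIntegralValue a 0 r := by
  induction r with
  | zero =>
    rw [gegenbauerIntegral_zero (by linarith), mixedIntegralValue,
      Real.Gamma_add_one (show 2 * a ≠ 0 by linarith)]
    have := (Real.Gamma_pos_of_pos (show 0 < 2 * a by linarith)).ne'
    have := (Real.Gamma_pos_of_pos (show 0 < 2 * a + 2 by linarith)).ne'
    simp only [Nat.cast_zero, mul_zero, add_zero, zero_add, Nat.factorial_zero, Nat.cast_one]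
    field_simp
    ring
  | succ r ih =>
    have h := gegenbauerIntegral_add_two (2 * r) ha.le
    have hr : (0 : ℝ) ≤ r := r.cast_nonneg
    rw [ih] at h
    have hne : ((2 * r : ℕ) + 1 + 2 * a) * ((2 * r : ℕ) + 3 + 2 * a) ≠ 0 := by positivity
    refine mul_left_cancel₀ hne (h.trans ?_)
    have g₁ : Real.Gamma (r + 1 + a + 1) = (r + a + 1) * Real.Gamma (r + a + 1) := by
      rw [← Real.Gamma_add_one (by positivity)]
      ring_nf
    have g₂ : Real.Gamma (2 * (r + 1) + 2 * a) =
        (2 * r + 2 * a + 1) * ((2 * r + 2 * a) * Real.Gamma (2 * r + 2 * a)) := by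
      rw [← Real.Gamma_add_one (by positivity), ← Real.Gamma_add_one (by positivity)]
      ring_nf
    have g₃ : Real.Gamma (2 * (r + 1) + 2 * a + 2) =
        (2 * r + 2 * a + 2 + 1) * ((2 * r + 2 * a + 2) * Real.Gamma (2 * r + 2 * a + 2)) := by
      rw [← Real.Gamma_add_one (by positivity), ← Real.Gamma_add_one (by positivity)]
      ring_nf
    have p₁ := (Real.Gamma_pos_of_pos (show 0 < 2 * r + 2 * a by positivity)).ne'
    have p₂ := (Real.Gamma_pos_of_pos (show 0 < 2 * r + 2 * a + 2 by positivity)).ne'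
    have p₃ := two_mul_natCast_sub_one_ne_zero r
    have p₄ : (2 * r + 1 : ℝ) ≠ 0 := by positivity
    simp only [mixedIntegralValue, zero_add, mul_add, mul_one, Nat.factorial_succ, Nat.cast_zero,
      add_zero, Nat.cast_add, Nat.cast_one, Nat.cast_mul, Nat.cast_ofNat]
    simp only [mul_add, mul_one] at g₁ g₂ g₃
    rw [g₁, g₂, g₃, show (2 * r + 2 - 1 : ℝ) = 2 * r + 1 by ring]
    field_simp
    ring

theorem integral_gegenbauer_mixed (k r : ℕ) {b : ℝ} (hb : 0 ≤ b) (hbk : 0 < b + k) :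
    ∫ t in (-1 : ℝ)..1, (gegenbauer k (b + 1 / 2)).eval t *
      (gegenbauer (k + 2 * r) b).eval t * (1 - t ^ 2) ^ b = mixedIntegralValue b k r := by
  induction k generalizing b with
  | zero =>
    rw [← gegenbauerIntegral_two_mul r (by simpa using hbk)]
    simp [gegenbauerIntegral, gegenbauer]
  | succ k ih =>
    have h := integral_gegenbauer_mixed_succ hb k (k + 2 * r)
    rw [ih (by linarith) (by positivity)] at h
    rw [add_right_comm k 1]
    have hne : (2 * b + 2) * (2 * b + 1) ≠ 0 := by positivity
    refine mul_left_cancel₀ hne (h.trans ?_)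
    have g₁ : Real.Gamma (2 * (b + 1) + 1) =
        (2 * b + 1 + 1) * ((2 * b + 1) * Real.Gamma (2 * b + 1)) := by
      rw [← Real.Gamma_add_one (by positivity), ← Real.Gamma_add_one (by positivity)]
      ring_nf
    have g₂ : Real.Gamma (k + 2 * r + 2 * (b + 1)) =
        (k + 1 + 2 * r + 2 * b) * Real.Gamma (k + 1 + 2 * r + 2 * b) := by
      rw [← Real.Gamma_add_one (by positivity)]
      ring_nf
    have p₁ := (Real.Gamma_pos_of_pos (show 0 < k + 1 + 2 * r + 2 * b by positivity)).ne'
    have p₂ := (Real.Gamma_pos_of_pos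
      (show 0 < 2 * r + 2 * (b + (k + 1)) + 2 by positivity)).ne'
    have p₃ := two_mul_natCast_sub_one_ne_zero r
    simp only [mixedIntegralValue, add_right_comm k 1, Nat.factorial_succ, Nat.cast_add,
      Nat.cast_one, Nat.cast_mul, Nat.cast_ofNat]
    rw [g₁, g₂, show b + 1 + (k : ℝ) = b + (k + 1) by ring,
      show (r : ℝ) + (b + 1) + k = r + b + (k + 1) by ring]
    field_simp
    ring

theorem mixedIntegralValue_eq_Ndim_cGeg {n : ℕ} (hn : 2 ≤ n) (k r : ℕ)
    (hne : ¬(n = 2 ∧ k = 0)) :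
    mixedIntegralValue (((n : ℝ) - 2) / 2) k r =
      (((n : ℝ) - 2) / 2 + (k + 2 * r : ℕ)) /
        (Ndim n (k + 2 * r) * (((n : ℝ) - 2) / 2 + (k : ℝ))) *
          cGeg (((n : ℝ) - 2) / 2 + (k : ℝ)) (2 * r) := by
  obtain ⟨d, rfl⟩ := Nat.exists_eq_add_of_le' hn
  have hdk : 0 < d + k := by omega
  obtain ⟨q, hq⟩ := Nat.exists_eq_add_of_le' (show 1 ≤ k + 2 * r + d by omega)
  have hq' : (k + 2 * r + d : ℝ) = q + 1 := by exact_mod_cast hq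
  have hb : (((d + 2 : ℕ) : ℝ) - 2) / 2 = d / 2 := by push_cast; ring
  have e₁ : k + 2 * r + (d + 2) - 3 = q := by omega
  have e₂ : 2 * (k + 2 * r) + (d + 2) - 2 = 2 * (k + 2 * r) + d := by omega
  have hdk' : (0 : ℝ) < d / 2 + k := by
    have : (0 : ℝ) < d + k := by exact_mod_cast hdk
    have : (0 : ℝ) ≤ k := k.cast_nonneg
    linarith
  have p₂ := (Real.Gamma_pos_of_pos (show (0 : ℝ) < 2 * r + 2 * (d / 2 + k) + 2 by positivity)).ne'
  have p₃ := two_mul_natCast_sub_one_ne_zero r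
  have p₄ : (r + d / 2 + k : ℝ) ≠ 0 := by rw [add_assoc]; positivity
  have p₅ : (2 * (k + 2 * r) + d : ℝ) ≠ 0 := by
    rw [show (2 * (k + 2 * r) + d : ℝ) = 2 * (d / 2 + k) + (4 * r) by ring]
    positivity
  have g₁ : Real.Gamma (2 * (d / 2) + 1) = (Nat.factorial d : ℝ) := by
    rw [mul_div_cancel₀ _ two_ne_zero, Real.Gamma_nat_eq_factorial]
  have g₂ : Real.Gamma (k + 2 * r + 2 * (d / 2)) = (Nat.factorial q : ℝ) := by
    rw [mul_div_cancel₀ _ two_ne_zero, hq', Real.Gamma_nat_eq_factorial]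
  rw [hb, mixedIntegralValue, Ndim, cGeg, e₁, e₂, g₁, g₂, Nat.add_sub_cancel]
  push_cast
  rw [mul_div_cancel_left₀ _ (two_ne_zero (α := ℝ)), Real.Gamma_nat_eq_factorial,
    show (r + (d / 2 + k) : ℝ) = r + d / 2 + k by ring,
    show (d / 2 + (k + 2 * r) : ℝ) = (2 * (k + 2 * r) + d) / 2 by ring]
  generalize (2 * (k + 2 * r) + d : ℝ) = u at *
  generalize (r + d / 2 + k : ℝ) = v at *
  generalize (d / 2 + k : ℝ) = x at *
  generalize (2 * r - 1 : ℝ) = y at *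
  have hx := hdk'.ne'
  field_simp

/-- for `l ≥ k`, `l − k` even, `(n,k) ≠ (2,0)`, with `β = (n−2)/2`,
`α = β + k`, `m = l − k`:
`∫_{−1}^{1} P_k^{n+1}(t) P_l^n(t) (1−t²)^{(n−2)/2} dt = ((β+l)/(N(n,l)(β+k))) c^α_m`. -/
theorem legendre_mixed_integral (n : ℕ) (hn : 2 ≤ n) (k l : ℕ) (hkl : k ≤ l)
    (heven : Even (l - k)) (hne : ¬(n = 2 ∧ k = 0)) :
    ∫ t in (-1 : ℝ)..1,
        legendreP (n + 1) k t * legendreP n l t * (1 - t ^ 2) ^ (((n : ℝ) - 2) / 2)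
      = ((((n : ℝ) - 2) / 2 + (l : ℝ)) / (Ndim n l * (((n : ℝ) - 2) / 2 + (k : ℝ)))) *
          cGeg (((n : ℝ) - 2) / 2 + (k : ℝ)) (l - k) := by
  obtain ⟨r, hr⟩ := heven
  obtain rfl : l = k + 2 * r := by omega
  have hn' : (2 : ℝ) ≤ n := by exact_mod_cast hn
  rw [show k + 2 * r - k = 2 * r by omega, ← mixedIntegralValue_eq_Ndim_cGeg hn k r hne,
    ← integral_gegenbauer_mixed k r (by linarith)]
  · refine intervalIntegral.integral_congr_Ioo_of_le (by norm_num) fun t ht => ?_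
    simp only [legendreP_eq_gegenbauer hn _ ht,
      legendreP_eq_gegenbauer (Nat.le_succ_of_le hn) _ ht]
    rw [show (((n + 1 : ℕ) : ℝ) - 2) / 2 = ((n : ℝ) - 2) / 2 + 1 / 2 by push_cast; ring]
  · rcases hn.eq_or_lt with rfl | h
    · have : 0 < k := by omega
      simpa using this
    · have : (2 : ℝ) < n := by exact_mod_cast h
      have : (0 : ℝ) ≤ k := k.cast_nonneg
      linarith
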